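/- arXiv:2002.02512 — 9 statements merged into one kernel-verified Lean document; each statement's English description precedes it below -/
import Mathlib

section
/- For a stream coalgebra c = ⟨h,t⟩ on K and all s₁,s₂ ∈ K: s₁ and s₂ are c-bisimilar if and only if they are not c-apart, i.e. s₁ ↔ s₂ iff ¬(s₁ # s₂). -/
/-- `R` is a bisimulation for the stream coalgebra `⟨h, t⟩`. -/
def IsStreamBisim {K A : Type*} (h : K → A) (t : K → K) (R : K → K → Prop) : Prop :=
  ∀ s₁ s₂, R s₁ s₂ → h s₁ = h s₂ ∧ R (t s₁) (t s₂)

/-- `Q` is an apartness for the stream coalgebra `⟨h, t⟩`. -/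
def IsStreamApartness {K A : Type*} (h : K → A) (t : K → K) (Q : K → K → Prop) : Prop :=
  (∀ s₁ s₂, Q (t s₁) (t s₂) → Q s₁ s₂) ∧ (∀ s₁ s₂, h s₁ ≠ h s₂ → Q s₁ s₂)

/-- `s₁` and `s₂` are bisimilar: related by some bisimulation. -/
def StreamBisimilar {K A : Type*} (h : K → A) (t : K → K) (s₁ s₂ : K) : Prop :=
  ∃ R, IsStreamBisim h t R ∧ R s₁ s₂

/-- `s₁` and `s₂` are apart: related by every apartness. -/
def StreamApart {K A : Type*} (h : K → A) (t : K → K) (s₁ s₂ : K) : Prop :=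
  ∀ Q, IsStreamApartness h t Q → Q s₁ s₂

/-- The complement of a bisimulation is an apartness. -/
theorem IsStreamBisim.isStreamApartness_not {K A : Type*} {h : K → A} {t : K → K}
    {R : K → K → Prop} (hR : IsStreamBisim h t R) :
    IsStreamApartness h t fun s₁ s₂ => ¬ R s₁ s₂ :=
  ⟨fun s₁ s₂ hQ hs => hQ (hR s₁ s₂ hs).2, fun s₁ s₂ hne hs => hne (hR s₁ s₂ hs).1⟩

/-- The complement of an apartness is a bisimulation. -/
theorem IsStreamApartness.isStreamBisim_not {K A : Type*} {h : K → A} {t : K → K}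
    {Q : K → K → Prop} (hQ : IsStreamApartness h t Q) :
    IsStreamBisim h t fun s₁ s₂ => ¬ Q s₁ s₂ :=
  fun s₁ s₂ hs => ⟨not_not.mp fun hne => hs (hQ.2 s₁ s₂ hne), fun ht => hs (hQ.1 s₁ s₂ ht)⟩

theorem streamBisimilar_iff_not_apart {K A : Type*} (h : K → A) (t : K → K) (s₁ s₂ : K) :
    StreamBisimilar h t s₁ s₂ ↔ ¬ StreamApart h t s₁ s₂ := by
  constructor
  · rintro ⟨R, hR, hs⟩ hapart
    exact hapart _ hR.isStreamApartness_not hs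
  · intro hapart
    obtain ⟨Q, hQ⟩ := not_forall.mp hapart
    obtain ⟨hQ, hs⟩ := Classical.not_imp.mp hQ
    exact ⟨_, hQ.isStreamBisim_not, hs⟩
end

section
/- In any LTS, branching bisimilarity ↔_b is itself a branching bisimulation, and it is the largest one: every branching bisimulation R satisfies R(q,p) implies q ↔_b p. -/
/-- `TauCl tau` is the reflexive-transitive closure `↠τ` of the silent-step relation. -/
def TauCl {X : Type*} (tau : X → X → Prop) : X → X → Prop := Relation.ReflTransGen tau

/-- `R` is a branching bisimulation on the LTS `(tau, step)`
(including the symmetric variants of the two transfer conditions). -/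
def IsBranchingBisim {X A : Type*} (tau : X → X → Prop) (step : A → X → X → Prop)
    (R : X → X → Prop) : Prop :=
  (∀ q p q', R q p → tau q q' →
    R q' p ∨ ∃ p' p'', TauCl tau p p' ∧ tau p' p'' ∧ R q p' ∧ R q' p'') ∧
  (∀ q p q' a, R q p → step a q q' →
    ∃ p' p'', TauCl tau p p' ∧ step a p' p'' ∧ R q p' ∧ R q' p'') ∧
  (∀ q p p', R q p → tau p p' →
    R q p' ∨ ∃ q' q'', TauCl tau q q' ∧ tau q' q'' ∧ R q' p ∧ R q'' p') ∧
  (∀ q p p' a, R q p → step a p p' →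
    ∃ q' q'', TauCl tau q q' ∧ step a q' q'' ∧ R q' p ∧ R q'' p')

/-- `q` and `p` are branching bisimilar: related by some branching bisimulation. -/
def BranchingBisimilar {X A : Type*} (tau : X → X → Prop) (step : A → X → X → Prop)
    (q p : X) : Prop :=
  ∃ R, IsBranchingBisim tau step R ∧ R q p

theorem branchingBisimilar_isBranchingBisim_and_largest {X A : Type*} (tau : X → X → Prop)
    (step : A → X → X → Prop) :
    IsBranchingBisim tau step (BranchingBisimilar tau step) ∧
    ∀ R, IsBranchingBisim tau step R → ∀ q p, R q p → BranchingBisimilar tau step q p := by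
  have largest : ∀ R, IsBranchingBisim tau step R →
      ∀ q p, R q p → BranchingBisimilar tau step q p := fun R hR _ _ h ↦ ⟨R, hR, h⟩
  refine ⟨⟨?_, ?_, ?_, ?_⟩, largest⟩
  · rintro q p q' ⟨R, hR, h⟩ hq
    exact (hR.1 q p q' h hq).imp (largest R hR _ _) fun ⟨p', p'', hcl, hp, h', h''⟩ ↦
      ⟨p', p'', hcl, hp, largest R hR _ _ h', largest R hR _ _ h''⟩
  · rintro q p q' a ⟨R, hR, h⟩ hq
    obtain ⟨p', p'', hcl, hp, h', h''⟩ := hR.2.1 q p q' a h hq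
    exact ⟨p', p'', hcl, hp, largest R hR _ _ h', largest R hR _ _ h''⟩
  · rintro q p p' ⟨R, hR, h⟩ hp
    exact (hR.2.2.1 q p p' h hp).imp (largest R hR _ _) fun ⟨q', q'', hcl, hq, h', h''⟩ ↦
      ⟨q', q'', hcl, hq, largest R hR _ _ h', largest R hR _ _ h''⟩
  · rintro q p p' a ⟨R, hR, h⟩ hp
    obtain ⟨q', q'', hcl, hq, h', h''⟩ := hR.2.2.2 q p p' a h hp
    exact ⟨q', q'', hcl, hq, largest R hR _ _ h', largest R hR _ _ h''⟩
end

section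
/- In any LTS, for all states q,p: q #_b p holds if and only if q ↔_b p fails, i.e. branching apartness is the complement of branching bisimilarity. -/
/-- `Q` is a branching apartness on the LTS `(tau, step)`. -/
def IsBranchingApartness {X A : Type*} (tau : X → X → Prop) (step : A → X → X → Prop)
    (Q : X → X → Prop) : Prop :=
  (∀ q p, Q p q → Q q p) ∧
  (∀ q q' p, tau q q' → Q q' p →
    (∀ p' p'', TauCl tau p p' → tau p' p'' → Q q p' ∨ Q q' p'') → Q q p) ∧
  (∀ q q' p a, step a q q' →
    (∀ p' p'', TauCl tau p p' → step a p' p'' → Q q p' ∨ Q q' p'') → Q q p)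

/-- `q` and `p` are branching apart: related by every branching apartness. -/
def BApart {X A : Type*} (tau : X → X → Prop) (step : A → X → X → Prop) (q p : X) : Prop :=
  ∀ Q, IsBranchingApartness tau step Q → Q q p

/-- The complement of a branching apartness is a branching bisimulation. -/
theorem IsBranchingApartness.isBranchingBisim_not {X A : Type*} {tau : X → X → Prop}
    {step : A → X → X → Prop} {Q : X → X → Prop} (hQ : IsBranchingApartness tau step Q) :
    IsBranchingBisim tau step fun q p => ¬ Q q p := by
  obtain ⟨hsymm, htau, hstep⟩ := hQ
  refine ⟨fun q p q' h ht => ?_, fun q p q' a h ht => ?_,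
    fun q p p' h ht => ?_, fun q p p' a h ht => ?_⟩
  · by_contra! hc
    exact h (htau q q' p ht hc.1 fun p' p'' h₁ h₂ => or_iff_not_imp_left.2 (hc.2 p' p'' h₁ h₂))
  · by_contra! hc
    exact h (hstep q q' p a ht fun p' p'' h₁ h₂ => or_iff_not_imp_left.2 (hc p' p'' h₁ h₂))
  · by_contra! hc
    exact h (hsymm _ _ (htau p p' q ht (hsymm _ _ hc.1) fun q' q'' h₁ h₂ =>
      or_iff_not_imp_left.2 fun hn =>
        hsymm _ _ (hc.2 q' q'' h₁ h₂ fun hq => hn (hsymm _ _ hq))))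
  · by_contra! hc
    exact h (hsymm _ _ (hstep p p' q a ht fun q' q'' h₁ h₂ =>
      or_iff_not_imp_left.2 fun hn =>
        hsymm _ _ (hc q' q'' h₁ h₂ fun hq => hn (hsymm _ _ hq))))

/-- The complement of the symmetric closure of a branching bisimulation is a branching
apartness. -/
theorem IsBranchingBisim.isBranchingApartness_not {X A : Type*} {tau : X → X → Prop}
    {step : A → X → X → Prop} {R : X → X → Prop} (hR : IsBranchingBisim tau step R) :
    IsBranchingApartness tau step fun q p => ¬ (R q p ∨ R p q) := by
  obtain ⟨htau, hstep, htau', hstep'⟩ := hR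
  refine ⟨fun q p h hqp => h hqp.symm, ?_, ?_⟩
  · rintro q q' p ht hn hall (h | h)
    · obtain h₁ | ⟨p', p'', h₁, h₂, h₃, h₄⟩ := htau q p q' h ht
      · exact hn (.inl h₁)
      · exact (hall p' p'' h₁ h₂).elim (· (.inl h₃)) (· (.inl h₄))
    · obtain h₁ | ⟨p', p'', h₁, h₂, h₃, h₄⟩ := htau' p q q' h ht
      · exact hn (.inr h₁)
      · exact (hall p' p'' h₁ h₂).elim (· (.inr h₃)) (· (.inr h₄))
  · rintro q q' p a ht hall (h | h)
    · obtain ⟨p', p'', h₁, h₂, h₃, h₄⟩ := hstep q p q' a h ht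
      exact (hall p' p'' h₁ h₂).elim (· (.inl h₃)) (· (.inl h₄))
    · obtain ⟨p', p'', h₁, h₂, h₃, h₄⟩ := hstep' p q q' a h ht
      exact (hall p' p'' h₁ h₂).elim (· (.inr h₃)) (· (.inr h₄))

theorem bApart_iff_not_branchingBisimilar {X A : Type*} (tau : X → X → Prop)
    (step : A → X → X → Prop) (q p : X) :
    BApart tau step q p ↔ ¬ BranchingBisimilar tau step q p := by
  constructor
  · rintro h ⟨R, hR, hqp⟩
    exact h _ hR.isBranchingApartness_not (.inl hqp)
  · intro h Q hQ
    by_contra hn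
    exact h ⟨_, hQ.isBranchingBisim_not, hn⟩
end

section
/- In any LTS, weak apartness is included in branching apartness: for all states s,t, if s #_w t then s #_b t. -/
/-- `Q` is a weak apartness on the LTS `(tau, step)`. -/
def IsWeakApartness {X A : Type*} (tau : X → X → Prop) (step : A → X → X → Prop)
    (Q : X → X → Prop) : Prop :=
  (∀ q p, Q p q → Q q p) ∧
  (∀ q q' p, tau q q' → (∀ p', TauCl tau p p' → Q q' p') → Q q p) ∧
  (∀ q q' p a, step a q q' →
    (∀ p' p'' p''', TauCl tau p p' → step a p' p'' → TauCl tau p'' p''' → Q q' p''') →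
    Q q p)

/-- `q` and `p` are weakly apart: related by every weak apartness. -/
def WApart {X A : Type*} (tau : X → X → Prop) (step : A → X → X → Prop) (q p : X) : Prop :=
  ∀ Q, IsWeakApartness tau step Q → Q q p

/-- Every branching apartness is a weak apartness. -/
theorem IsBranchingApartness.isWeakApartness {X A : Type*} {tau : X → X → Prop}
    {step : A → X → X → Prop} {Q : X → X → Prop} (hQ : IsBranchingApartness tau step Q) :
    IsWeakApartness tau step Q := by
  obtain ⟨hsymm, htau, hstep⟩ := hQ
  refine ⟨hsymm, fun q q' p hq h => ?_, fun q q' p a hq h => ?_⟩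
  · exact htau q q' p hq (h p .refl) fun p' p'' hp hp' => .inr (h p'' (hp.tail hp'))
  · exact hstep q q' p a hq fun p' p'' hp hp' => .inr (h p' p'' p'' hp hp' .refl)

theorem wApart_imp_bApart {X A : Type*} (tau : X → X → Prop) (step : A → X → X → Prop)
    (s t : X) (h : WApart tau step s t) : BApart tau step s t := fun Q hQ =>
  h Q hQ.isWeakApartness
end

section
/- In any LTS, semi-branching apartness is included in branching apartness: for all states q,p, if q #_sb p then q #_b p. -/
/-- `Q` is a semi-branching apartness on the LTS `(tau, step)`. -/
def IsSemiBranchingApartness {X A : Type*} (tau : X → X → Prop) (step : A → X → X → Prop)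
    (Q : X → X → Prop) : Prop :=
  (∀ q p, Q p q → Q q p) ∧
  (∀ q q' p, tau q q' → Q q' p →
    (∀ p' p'', TauCl tau p p' → tau p' p'' → Q q' p'' ∨ (Q q p' ∧ Q q p'')) → Q q p) ∧
  (∀ q q' p a, step a q q' →
    (∀ p' p'', TauCl tau p p' → step a p' p'' → Q q p' ∨ Q q' p'') → Q q p)

/-- `q` and `p` are semi-branching apart: related by every semi-branching apartness. -/
def SbApart {X A : Type*} (tau : X → X → Prop) (step : A → X → X → Prop) (q p : X) : Prop :=
  ∀ Q, IsSemiBranchingApartness tau step Q → Q q p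

/-- Every branching apartness is a semi-branching apartness. -/
theorem IsBranchingApartness.isSemiBranchingApartness {X A : Type*} {tau : X → X → Prop}
    {step : A → X → X → Prop} {Q : X → X → Prop} (hQ : IsBranchingApartness tau step Q) :
    IsSemiBranchingApartness tau step Q :=
  ⟨hQ.1, fun q q' p hq hp H => hQ.2.1 q q' p hq hp fun p' p'' h₁ h₂ =>
    (H p' p'' h₁ h₂).elim Or.inr fun h => Or.inl h.1, hQ.2.2⟩

theorem sbApart_imp_bApart {X A : Type*} (tau : X → X → Prop) (step : A → X → X → Prop)
    (q p : X) (h : SbApart tau step q p) : BApart tau step q p := by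
  exact fun Q hQ => h Q hQ.isSemiBranchingApartness
end

section
/- In any LTS, the following two derived rules hold for semi-branching apartness #_sb: (1) if p ↠τ t, q →τ q', q' #_sb p, and for all p',p'' with p ↠τ p' →τ p'' one has q' #_sb p'' or (q #_sb p' and q #_sb p''), then q #_sb t; (2) if p ↠τ t, q →_a q' for some a ∈ A, and for all p',p'' with p ↠τ p' →_a p'' one has q #_sb p' or q' #_sb p'', then q #_sb t. -/
/-- Semi-branching apartness is itself a semi-branching apartness. -/
theorem isSemiBranchingApartness_sbApart {X A : Type*} (tau : X → X → Prop)
    (step : A → X → X → Prop) :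
    IsSemiBranchingApartness tau step (SbApart tau step) := by
  refine ⟨fun q p h Q hQ => hQ.1 q p (h Q hQ), ?_, ?_⟩
  · intro q q' p hqq' hq'p h Q hQ
    exact hQ.2.1 q q' p hqq' (hq'p Q hQ) fun p' p'' hp hp' =>
      (h p' p'' hp hp').imp (fun k => k Q hQ) fun k => ⟨k.1 Q hQ, k.2 Q hQ⟩
  · intro q q' p a hqq' h Q hQ
    exact hQ.2.2 q q' p a hqq' fun p' p'' hp hp' =>
      (h p' p'' hp hp').imp (fun k => k Q hQ) fun k => k Q hQ

theorem sbApart_derived_rules {X A : Type*} (tau : X → X → Prop) (step : A → X → X → Prop) :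
    (∀ p t q q', TauCl tau p t → tau q q' → SbApart tau step q' p →
      (∀ p' p'', TauCl tau p p' → tau p' p'' →
        SbApart tau step q' p'' ∨ (SbApart tau step q p' ∧ SbApart tau step q p'')) →
      SbApart tau step q t) ∧
    (∀ p t q q' (a : A), TauCl tau p t → step a q q' →
      (∀ p' p'', TauCl tau p p' → step a p' p'' →
        SbApart tau step q p' ∨ SbApart tau step q' p'') →
      SbApart tau step q t) := by
  obtain ⟨-, in_sb, in_b⟩ := isSemiBranchingApartness_sbApart tau step
  refine ⟨fun p t q q' hpt hqq' hq'p h => ?_, fun p t q q' a hpt hqq' h =>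
    in_b q q' t a hqq' fun p' p'' hp => h p' p'' (Relation.ReflTransGen.trans hpt hp)⟩
  have of_apart (hq't : SbApart tau step q' t) : SbApart tau step q t :=
    in_sb q q' t hqq' hq't fun p' p'' hp => h p' p'' (Relation.ReflTransGen.trans hpt hp)
  rcases Relation.ReflTransGen.cases_tail hpt with rfl | ⟨r, hpr, hrt⟩
  · exact of_apart hq'p
  · exact (h r t hpr hrt).elim of_apart And.right
end

section
/- In any LTS, the following two derived rules hold for semi-branching apartness #_sb: (1) if q₀ ↠τ q →τ q', q' #_sb p, and for all p',p'' with p ↠τ p' →τ p'' one has q' #_sb p'' or (q #_sb p' and q #_sb p''), then q₀ #_sb p; (2) if q₀ ↠τ q →_a q' for some a ∈ A and for all p',p'' with p ↠τ p' →_a p'' one has q #_sb p' or q' #_sb p'', then q₀ #_sb p. -/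
/-- A sequence of silent steps from one of two non-apart states can be matched by the other. -/
theorem IsSemiBranchingApartness.exists_tauCl_not {X A : Type*} {tau : X → X → Prop}
    {step : A → X → X → Prop} {Q : X → X → Prop} (hQ : IsSemiBranchingApartness tau step Q)
    {q₀ q p : X} (hq : TauCl tau q₀ q) (h : ¬ Q q₀ p) : ∃ p₁, TauCl tau p p₁ ∧ ¬ Q q p₁ := by
  induction hq with
  | refl => exact ⟨p, Relation.ReflTransGen.refl, h⟩
  | @tail r r' _ hs ih =>
    obtain ⟨p₁, hp₁, hr⟩ := ih
    by_contra! hc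
    exact hr (hQ.2.1 r r' p₁ hs (hc p₁ hp₁) fun p' p'' h₁ h₂ =>
      Or.inl (hc p'' ((Relation.ReflTransGen.trans hp₁ h₁).tail h₂)))

theorem sbApart_derived_rules' {X A : Type*} (tau : X → X → Prop) (step : A → X → X → Prop) :
    (∀ q₀ q q' p, TauCl tau q₀ q → tau q q' → SbApart tau step q' p →
      (∀ p' p'', TauCl tau p p' → tau p' p'' →
        SbApart tau step q' p'' ∨ (SbApart tau step q p' ∧ SbApart tau step q p'')) →
      SbApart tau step q₀ p) ∧
    (∀ q₀ q q' p (a : A), TauCl tau q₀ q → step a q q' →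
      (∀ p' p'', TauCl tau p p' → step a p' p'' →
        SbApart tau step q p' ∨ SbApart tau step q' p'') →
      SbApart tau step q₀ p) := by
  have hQ := isSemiBranchingApartness_sbApart tau step
  refine ⟨fun q₀ q q' p hq hs hp h => ?_, fun q₀ q q' p a hq hs h => ?_⟩
  · by_contra hn
    obtain ⟨p₁, hp₁, hr⟩ := hQ.exists_tauCl_not hq hn
    refine hr (hQ.2.1 q q' p₁ hs ?_ fun p' p'' h₁ h₂ =>
      h p' p'' (Relation.ReflTransGen.trans hp₁ h₁) h₂)
    rcases Relation.ReflTransGen.cases_tail hp₁ with rfl | ⟨p', hp', hs'⟩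
    · exact hp
    · exact (h p' p₁ hp' hs').resolve_right fun k => hr k.2
  · by_contra hn
    obtain ⟨p₁, hp₁, hr⟩ := hQ.exists_tauCl_not hq hn
    exact hr (hQ.2.2 q q' p₁ a hs fun p' p'' h₁ h₂ =>
      h p' p'' (Relation.ReflTransGen.trans hp₁ h₁) h₂)
end

section
/- In any LTS, branching apartness #_b is co-transitive: for all states q,p,r, if q #_b p then q #_b r or r #_b p. -/
open Relation

/-- Symmetric semi-branching bisimulations: a silent step may be answered by silent steps whose
last one is optional. Unlike branching bisimulations, they are closed under composition. -/
structure IsSemiBranchingBisim {X A : Type*} (tau : X → X → Prop) (step : A → X → X → Prop)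
    (R : X → X → Prop) : Prop where
  symm : ∀ {q p}, R q p → R p q
  tau_step : ∀ {q q' p}, R q p → tau q q' →
    ∃ p' p'', ReflTransGen tau p p' ∧ ReflGen tau p' p'' ∧ R q p' ∧ R q' p''
  vis_step : ∀ {a q q' p}, R q p → step a q q' →
    ∃ p' p'', ReflTransGen tau p p' ∧ step a p' p'' ∧ R q p' ∧ R q' p''

/-- The largest symmetric semi-branching bisimulation. -/
def SemiBranchingBisimilar {X A : Type*} (tau : X → X → Prop) (step : A → X → X → Prop)
    (q p : X) : Prop :=
  ∃ R, IsSemiBranchingBisim tau step R ∧ R q p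

section

variable {X A : Type*} {tau : X → X → Prop} {step : A → X → X → Prop}

namespace IsSemiBranchingBisim

variable {R : X → X → Prop}

theorem refl_tau_step (hR : IsSemiBranchingBisim tau step R) {q q' p : X} (h : R q p)
    (hq : ReflGen tau q q') :
    ∃ p' p'', ReflTransGen tau p p' ∧ ReflGen tau p' p'' ∧ R q p' ∧ R q' p'' := by
  cases hq with
  | refl => exact ⟨p, p, .refl, .refl, h, h⟩
  | single hq => exact hR.tau_step h hq

theorem tau_steps (hR : IsSemiBranchingBisim tau step R) {q q' p : X} (h : R q p)
    (hq : ReflTransGen tau q q') : ∃ p', ReflTransGen tau p p' ∧ R q' p' := by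
  induction hq with
  | refl => exact ⟨p, .refl, h⟩
  | tail _ hs ih =>
    obtain ⟨p₁, hp₁, h₁⟩ := ih
    obtain ⟨p₂, p₃, hp₂, hp₃, -, h₃⟩ := hR.tau_step h₁ hs
    exact ⟨p₃, (hp₁.trans hp₂).trans hp₃.to_reflTransGen, h₃⟩

theorem comp_self (hR : IsSemiBranchingBisim tau step R) :
    IsSemiBranchingBisim tau step (Comp R R) where
  symm := fun ⟨r, h₁, h₂⟩ => ⟨r, hR.symm h₂, hR.symm h₁⟩
  tau_step := by
    rintro q q' p ⟨r, h₁, h₂⟩ hq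
    obtain ⟨r', r'', hr, hr', h', h''⟩ := hR.tau_step h₁ hq
    obtain ⟨p₀, hp₀, h₀⟩ := hR.tau_steps h₂ hr
    obtain ⟨p', p'', hp, hp', k', k''⟩ := hR.refl_tau_step h₀ hr'
    exact ⟨p', p'', hp₀.trans hp, hp', ⟨r', h', k'⟩, ⟨r'', h'', k''⟩⟩
  vis_step := by
    rintro a q q' p ⟨r, h₁, h₂⟩ hq
    obtain ⟨r', r'', hr, hr', h', h''⟩ := hR.vis_step h₁ hq
    obtain ⟨p₀, hp₀, h₀⟩ := hR.tau_steps h₂ hr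
    obtain ⟨p', p'', hp, hp', k', k''⟩ := hR.vis_step h₀ hr'
    exact ⟨p', p'', hp₀.trans hp, hp', ⟨r', h', k'⟩, ⟨r'', h'', k''⟩⟩

end IsSemiBranchingBisim

theorem isSemiBranchingBisim_semiBranchingBisimilar :
    IsSemiBranchingBisim tau step (SemiBranchingBisimilar tau step) where
  symm := fun ⟨R, hR, h⟩ => ⟨R, hR, hR.symm h⟩
  tau_step := by
    rintro q q' p ⟨R, hR, h⟩ hq
    obtain ⟨p', p'', hp, hp', h', h''⟩ := hR.tau_step h hq
    exact ⟨p', p'', hp, hp', ⟨R, hR, h'⟩, ⟨R, hR, h''⟩⟩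
  vis_step := by
    rintro a q q' p ⟨R, hR, h⟩ hq
    obtain ⟨p', p'', hp, hp', h', h''⟩ := hR.vis_step h hq
    exact ⟨p', p'', hp, hp', ⟨R, hR, h'⟩, ⟨R, hR, h''⟩⟩

theorem isSemiBranchingBisim_eq : IsSemiBranchingBisim tau step (· = ·) where
  symm := Eq.symm
  tau_step := by
    rintro q q' _ rfl hq
    exact ⟨q, q', .refl, .single hq, rfl, rfl⟩
  vis_step := by
    rintro a q q' _ rfl hq
    exact ⟨q, q', .refl, hq, rfl, rfl⟩

namespace SemiBranchingBisimilar

theorem refl (q : X) : SemiBranchingBisimilar tau step q q :=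
  ⟨_, isSemiBranchingBisim_eq, rfl⟩

theorem symm {q p : X} (h : SemiBranchingBisimilar tau step q p) :
    SemiBranchingBisimilar tau step p q :=
  isSemiBranchingBisim_semiBranchingBisimilar.symm h

theorem trans {q r p : X} (h₁ : SemiBranchingBisimilar tau step q r)
    (h₂ : SemiBranchingBisimilar tau step r p) : SemiBranchingBisimilar tau step q p :=
  ⟨_, isSemiBranchingBisim_semiBranchingBisimilar.comp_self, r, h₁, h₂⟩

/-- The stuttering property: states on a silent path between bisimilar states are bisimilar to
its endpoints. -/
theorem stuttering {p r p' : X} (hpr : ReflTransGen tau p r) (hrp : ReflTransGen tau r p')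
    (h : SemiBranchingBisimilar tau step p p') : SemiBranchingBisimilar tau step p r := by
  let T : X → X → Prop := fun x y =>
    ReflTransGen tau x y ∧ ∃ z, ReflTransGen tau y z ∧ SemiBranchingBisimilar tau step x z
  refine ⟨fun x y => SemiBranchingBisimilar tau step x y ∨ T x y ∨ T y x, ⟨?_, ?_, ?_⟩,
    .inr (.inl ⟨hpr, p', hrp, h⟩)⟩
  · rintro x y (h | h | h)
    · exact .inl h.symm
    · exact .inr (.inr h)
    · exact .inr (.inl h)
  · rintro x x' y (h | ⟨-, z, hyz, h⟩ | ⟨hyx, -⟩) hx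
    · obtain ⟨u, v, hu, hv, h', h''⟩ :=
        isSemiBranchingBisim_semiBranchingBisimilar.tau_step h hx
      exact ⟨u, v, hu, hv, .inl h', .inl h''⟩
    · obtain ⟨u, v, hu, hv, h', h''⟩ :=
        isSemiBranchingBisim_semiBranchingBisimilar.tau_step h hx
      exact ⟨u, v, hyz.trans hu, hv, .inl h', .inl h''⟩
    · exact ⟨x, x', hyx, .single hx, .inl (refl x), .inl (refl x')⟩
  · rintro a x x' y (h | ⟨-, z, hyz, h⟩ | ⟨hyx, -⟩) hx
    · obtain ⟨u, v, hu, hv, h', h''⟩ :=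
        isSemiBranchingBisim_semiBranchingBisimilar.vis_step h hx
      exact ⟨u, v, hu, hv, .inl h', .inl h''⟩
    · obtain ⟨u, v, hu, hv, h', h''⟩ :=
        isSemiBranchingBisim_semiBranchingBisimilar.vis_step h hx
      exact ⟨u, v, hyz.trans hu, hv, .inl h', .inl h''⟩
    · exact ⟨x, x', hyx, hx, .inl (refl x), .inl (refl x')⟩

end SemiBranchingBisimilar

theorem isBranchingApartness_not_semiBranchingBisimilar :
    IsBranchingApartness tau step fun q p => ¬ SemiBranchingBisimilar tau step q p := by
  refine ⟨fun q p h h' => h h'.symm, fun q q' p hq hq' H h => ?_, fun q q' p a hq H h => ?_⟩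
  · obtain ⟨p', p'', hp, hp', h', h''⟩ :=
      isSemiBranchingBisim_semiBranchingBisimilar.tau_step h hq
    cases hp' with
    | single hs => exact (H p' p'' hp hs).elim (· h') (· h'')
    | refl =>
      rcases ReflTransGen.cases_tail hp with rfl | ⟨r, hr, hs⟩
      · exact hq' h''
      · have hpr := SemiBranchingBisimilar.stuttering hr (.single hs) (h.symm.trans h')
        exact (H r p' hr hs).elim (· (h.trans hpr)) (· h'')
  · obtain ⟨p', p'', hp, hs, h', h''⟩ :=
      isSemiBranchingBisim_semiBranchingBisimilar.vis_step h hq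
    exact (H p' p'' hp hs).elim (· h') (· h'')

theorem IsBranchingApartness.isSemiBranchingBisim_not {Q : X → X → Prop}
    (hQ : IsBranchingApartness tau step Q) :
    IsSemiBranchingBisim tau step fun q p => ¬ Q q p where
  symm := fun h h' => h (hQ.1 _ _ h')
  tau_step := by
    intro q q' p h hq
    by_cases hq' : Q q' p
    · by_contra! H
      exact h (hQ.2.1 q q' p hq hq' fun p' p'' hp hs =>
        or_iff_not_imp_left.2 (H p' p'' hp (.single hs)))
    · exact ⟨p, p, .refl, .refl, h, hq'⟩
  vis_step := by
    intro a q q' p h hq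
    by_contra! H
    exact h (hQ.2.2 q q' p a hq fun p' p'' hp hs => or_iff_not_imp_left.2 (H p' p'' hp hs))

theorem bApart_iff_not_semiBranchingBisimilar {q p : X} :
    BApart tau step q p ↔ ¬ SemiBranchingBisimilar tau step q p := by
  refine ⟨fun h => h _ isBranchingApartness_not_semiBranchingBisimilar, fun h Q hQ => ?_⟩
  by_contra hqp
  exact h ⟨_, hQ.isSemiBranchingBisim_not, hqp⟩

end

theorem bApart_cotransitive {X A : Type*} (tau : X → X → Prop) (step : A → X → X → Prop)
    (q p r : X) (h : BApart tau step q p) :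
    BApart tau step q r ∨ BApart tau step r p := by
  simp only [bApart_iff_not_semiBranchingBisimilar] at h ⊢
  by_contra! H
  exact h (H.1.trans H.2)
end

section
/- In any LTS, branching apartness #_b is a proper apartness relation: it is irreflexive, symmetric, and co-transitive. -/
/-- A relation `Q` is a proper apartness if it is irreflexive, symmetric and co-transitive. -/
def ProperApartness {X : Type*} (Q : X → X → Prop) : Prop :=
  (∀ x, ¬ Q x x) ∧ (∀ x y, Q x y → Q y x) ∧ (∀ x y z, Q x y → Q x z ∨ Q z y)

/-- `R` lets the right-hand state match every `T`-step of the left-hand state, after some silent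
steps that stay related to the source of the step. -/
def Transfers {X : Type*} (tau T R : X → X → Prop) : Prop :=
  ∀ q q' p, T q q' → R q p → ∃ p' p'', TauCl tau p p' ∧ T p' p'' ∧ R q p' ∧ R q' p''

/-- Semi-branching bisimulations: a silent step may be matched by silent steps alone. -/
structure IsSemiBranching {X A : Type*} (tau : X → X → Prop) (step : A → X → X → Prop)
    (R : X → X → Prop) : Prop where
  symm : ∀ q p, R q p → R p q
  silent : Transfers tau (Relation.ReflGen tau) R
  visible : ∀ a, Transfers tau (step a) R

/-- Semi-branching bisimilarity. -/
def SemiBisim {X A : Type*} (tau : X → X → Prop) (step : A → X → X → Prop) (q p : X) : Prop :=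
  ∃ R, IsSemiBranching tau step R ∧ R q p

section

variable {X A : Type*} {tau T R S : X → X → Prop} {step : A → X → X → Prop}

theorem Transfers.tauCl (h : Transfers tau (Relation.ReflGen tau) R) {q q' p : X}
    (hq : TauCl tau q q') (hR : R q p) : ∃ p', TauCl tau p p' ∧ R q' p' := by
  induction hq with
  | refl => exact ⟨p, .refl, hR⟩
  | tail _ hstep ih =>
    obtain ⟨p₁, hp₁, hR₁⟩ := ih
    obtain ⟨p', p'', hp', hp'', -, hR''⟩ := h _ _ _ (.single hstep) hR₁
    exact ⟨p'', (hp₁.trans hp').trans hp''.to_reflTransGen, hR''⟩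

theorem Transfers.comp (hR : Transfers tau T R) (hS : Transfers tau T S)
    (hS' : Transfers tau (Relation.ReflGen tau) S) :
    Transfers tau T (Relation.Comp R S) := by
  rintro q q' p hq ⟨r, hqr, hrp⟩
  obtain ⟨r', r'', hr', hr'', h₁, h₂⟩ := hR _ _ _ hq hqr
  obtain ⟨p₁, hp₁, h₃⟩ := hS'.tauCl hr' hrp
  obtain ⟨p', p'', hp', hp'', h₄, h₅⟩ := hS _ _ _ hr'' h₃
  exact ⟨p', p'', hp₁.trans hp', hp'', ⟨r', h₁, h₄⟩, ⟨r'', h₂, h₅⟩⟩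

theorem Transfers.or (hR : Transfers tau T R) (hS : Transfers tau T S) :
    Transfers tau T (fun q p => R q p ∨ S q p) := by
  rintro q q' p hq (h | h)
  · obtain ⟨p', p'', h₁, h₂, h₃, h₄⟩ := hR _ _ _ hq h
    exact ⟨p', p'', h₁, h₂, .inl h₃, .inl h₄⟩
  · obtain ⟨p', p'', h₁, h₂, h₃, h₄⟩ := hS _ _ _ hq h
    exact ⟨p', p'', h₁, h₂, .inr h₃, .inr h₄⟩

theorem IsSemiBranching.comp_or (hR : IsSemiBranching tau step R)
    (hS : IsSemiBranching tau step S) :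
    IsSemiBranching tau step (fun q p => Relation.Comp R S q p ∨ Relation.Comp S R q p) where
  symm := by
    rintro q p (⟨r, h₁, h₂⟩ | ⟨r, h₁, h₂⟩)
    · exact .inr ⟨r, hS.symm _ _ h₂, hR.symm _ _ h₁⟩
    · exact .inl ⟨r, hR.symm _ _ h₂, hS.symm _ _ h₁⟩
  silent := (hR.silent.comp hS.silent hS.silent).or (hS.silent.comp hR.silent hR.silent)
  visible a :=
    ((hR.visible a).comp (hS.visible a) hS.silent).or ((hS.visible a).comp (hR.visible a) hR.silent)

namespace SemiBisim

theorem refl (q : X) : SemiBisim tau step q q := by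
  refine ⟨Eq, ⟨fun _ _ => Eq.symm, ?_, fun a => ?_⟩, rfl⟩ <;>
  · rintro q q' _ hq rfl
    exact ⟨q, q', .refl, hq, rfl, rfl⟩

theorem symm {q p : X} : SemiBisim tau step q p → SemiBisim tau step p q :=
  fun ⟨R, hR, h⟩ => ⟨R, hR, hR.symm _ _ h⟩

theorem trans {q r p : X} :
    SemiBisim tau step q r → SemiBisim tau step r p → SemiBisim tau step q p :=
  fun ⟨_, hR, h₁⟩ ⟨_, hS, h₂⟩ => ⟨_, hR.comp_or hS, .inl ⟨r, h₁, h₂⟩⟩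

theorem isSemiBranching : IsSemiBranching tau step (SemiBisim tau step) where
  symm _ _ := symm
  silent := by
    rintro q q' p hq ⟨R, hR, h⟩
    obtain ⟨p', p'', h₁, h₂, h₃, h₄⟩ := hR.silent _ _ _ hq h
    exact ⟨p', p'', h₁, h₂, ⟨R, hR, h₃⟩, ⟨R, hR, h₄⟩⟩
  visible a := by
    rintro q q' p hq ⟨R, hR, h⟩
    obtain ⟨p', p'', h₁, h₂, h₃, h₄⟩ := hR.visible a _ _ _ hq h
    exact ⟨p', p'', h₁, h₂, ⟨R, hR, h₃⟩, ⟨R, hR, h₄⟩⟩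

end SemiBisim

/-- `p` and `r` are the start and an intermediate state of a silent path whose endpoints are
semi-branching bisimilar. -/
def Stutters (tau : X → X → Prop) (step : A → X → X → Prop) (p r : X) : Prop :=
  ∃ p', TauCl tau p r ∧ TauCl tau r p' ∧ SemiBisim tau step p p'

theorem Transfers.stutters (hT : Transfers tau T (SemiBisim tau step)) :
    Transfers tau T
      (fun q p => SemiBisim tau step q p ∨ Stutters tau step q p ∨ Stutters tau step p q) := by
  rintro q q' p hq (h | ⟨r, -, hr, h⟩ | ⟨-, hr, -⟩)
  · obtain ⟨p', p'', h₁, h₂, h₃, h₄⟩ := hT _ _ _ hq h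
    exact ⟨p', p'', h₁, h₂, .inl h₃, .inl h₄⟩
  · obtain ⟨p', p'', h₁, h₂, h₃, h₄⟩ := hT _ _ _ hq h
    exact ⟨p', p'', hr.trans h₁, h₂, .inl h₃, .inl h₄⟩
  · exact ⟨q, q', hr, hq, .inl (.refl q), .inl (.refl q')⟩

theorem Stutters.semiBisim {p r : X} (h : Stutters tau step p r) : SemiBisim tau step p r := by
  refine ⟨_, ⟨?_, SemiBisim.isSemiBranching.silent.stutters,
    fun a => (SemiBisim.isSemiBranching.visible a).stutters⟩, .inr (.inl h)⟩
  rintro q p (h | h | h)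
  exacts [.inl h.symm, .inr (.inr h), .inr (.inl h)]

theorem SemiBisim.silent_step {q q' p : X} (hq : tau q q') (h : SemiBisim tau step q p) :
    SemiBisim tau step q' p ∨ ∃ p' p'', TauCl tau p p' ∧ tau p' p'' ∧
      SemiBisim tau step q p' ∧ SemiBisim tau step q' p'' := by
  obtain ⟨p', p'', h₁, h₂, h₃, h₄⟩ := isSemiBranching.silent _ _ _ (.single hq) h
  cases h₂ with
  | single h₂ => exact .inr ⟨p', p'', h₁, h₂, h₃, h₄⟩
  | refl =>
    rcases Relation.ReflTransGen.cases_tail h₁ with rfl | ⟨r, hr, hrp⟩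
    · exact .inl h₄
    · have hst : Stutters tau step p r := ⟨p', hr, .single hrp, h.symm.trans h₃⟩
      exact .inr ⟨r, p', hr, hrp, h.trans hst.semiBisim, h₄⟩

theorem isBranchingApartness_not_semiBisim :
    IsBranchingApartness tau step (fun q p => ¬ SemiBisim tau step q p) := by
  refine ⟨fun q p h h' => h h'.symm, fun q q' p hq hn hall h => ?_, fun q q' p a hq hall h => ?_⟩
  · obtain h' | ⟨p', p'', h₁, h₂, h₃, h₄⟩ := h.silent_step hq
    · exact hn h'
    · exact (hall p' p'' h₁ h₂).elim (· h₃) (· h₄)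
  · obtain ⟨p', p'', h₁, h₂, h₃, h₄⟩ := SemiBisim.isSemiBranching.visible a _ _ _ hq h
    exact (hall p' p'' h₁ h₂).elim (· h₃) (· h₄)

theorem IsBranchingApartness.isSemiBranching_not {Q : X → X → Prop}
    (hQ : IsBranchingApartness tau step Q) : IsSemiBranching tau step (fun q p => ¬ Q q p) where
  symm q p h h' := h (hQ.1 _ _ h')
  silent := by
    intro q q' p hq h
    cases hq with
    | refl => exact ⟨p, p, .refl, .refl, h, h⟩
    | single hq =>
      by_cases h' : Q q' p
      · by_contra! hn
        refine h (hQ.2.1 _ _ _ hq h' fun p' p'' h₁ h₂ => ?_)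
        exact or_iff_not_imp_left.2 (hn p' p'' h₁ (.single h₂))
      · exact ⟨p, p, .refl, .refl, h, h'⟩
  visible a := by
    intro q q' p hq h
    by_contra! hn
    exact h (hQ.2.2 _ _ _ a hq fun p' p'' h₁ h₂ => or_iff_not_imp_left.2 (hn p' p'' h₁ h₂))

theorem bApart_iff_not_semiBisim {q p : X} :
    BApart tau step q p ↔ ¬ SemiBisim tau step q p := by
  refine ⟨fun h => h _ isBranchingApartness_not_semiBisim, fun h Q hQ => ?_⟩
  by_contra hn
  exact h ⟨_, hQ.isSemiBranching_not, hn⟩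

end

theorem bApart_properApartness {X A : Type*} (tau : X → X → Prop)
    (step : A → X → X → Prop) :
    ProperApartness (BApart tau step) := by
  simp only [ProperApartness, bApart_iff_not_semiBisim]
  refine ⟨fun x h => h (.refl x), fun x y h h' => h h'.symm, fun x y z h => ?_⟩
  by_contra! hn
  exact h (hn.1.trans hn.2)
end
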